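/- arXiv:1804.05956 — 2 statements merged into one kernel-verified Lean document; each statement's English description precedes it below -/
import Mathlib

section
/- Let A₁ and A₂ be nonempty lists of real numbers, let S₁, S₂ be the multisets of sums of all nonempty contiguous subarrays of A₁ and A₂ respectively, and let C be the multiset of sums of all crossing subarrays of A₁ ++ A₂. Then for every k ∈ ℕ, topk(S(A₁ ++ A₂)) = topk(topk(S₁) + topk(S₂) + topk(C)), where + denotes multiset union. (This is the correctness of the combine step of the divide-and-conquer k-maximum subarrays algorithm.) -/
/-- The multiset of the `min k |S|` largest elements of a finite multiset `S` of reals: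
the first `min k |S|` entries of `S` sorted in nonincreasing order. -/
noncomputable def topk (k : ℕ) (S : Multiset ℝ) : Multiset ℝ :=
  ((S.sort (· ≥ ·)).take k : List ℝ)

/-- The multiset of sums of all nonempty contiguous subarrays `A[i..j]`, `0 ≤ i ≤ j < n`,
of `A`; the subarray `A[i..j]` is `(A.drop i).take (j - i + 1)`. -/
noncomputable def subSums (A : List ℝ) : Multiset ℝ :=
  (Finset.range A.length).val.bind fun i =>
    (Finset.range (A.length - i)).val.map fun l => ((A.drop i).take (l + 1)).sum

/-- The multiset of sums of all crossing subarrays of `A₁ ++ A₂`: a crossing subarray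
starts at index `i ∈ [0, n₁)` and ends at index `n₁ + t` with `t ∈ [0, n₂)`. -/
noncomputable def crossingSums (A₁ A₂ : List ℝ) : Multiset ℝ :=
  (Finset.range A₁.length ×ˢ Finset.range A₂.length).val.map fun p =>
    (((A₁ ++ A₂).drop p.1).take (A₁.length + p.2 + 1 - p.1)).sum

theorem Multiset.sort_add_of_forall_le (X Y : Multiset ℝ) (h : ∀ x ∈ X, ∀ y ∈ Y, y ≤ x) :
    (X + Y).sort (· ≥ ·) = X.sort (· ≥ ·) ++ Y.sort (· ≥ ·) := by
  refine List.Perm.eq_of_pairwise' (r := (· ≥ ·)) (Multiset.pairwise_sort _ _) ?_ ?_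
  · refine List.pairwise_append.2 ⟨Multiset.pairwise_sort _ _, Multiset.pairwise_sort _ _, ?_⟩
    intro a ha b hb
    exact h a (by simpa using ha) b (by simpa using hb)
  · rw [← Multiset.coe_eq_coe, ← Multiset.coe_add]
    simp only [Multiset.sort_eq]

theorem topk_add_of_forall_le (k : ℕ) (X Y : Multiset ℝ) (hk : k ≤ X.card)
    (h : ∀ x ∈ X, ∀ y ∈ Y, y ≤ x) : topk k (X + Y) = topk k X := by
  unfold topk
  rw [Multiset.sort_add_of_forall_le X Y h, List.take_append_of_le_length (by simpa using hk)]

theorem topk_eq_self_of_card_le (k : ℕ) (S : Multiset ℝ) (h : S.card ≤ k) : topk k S = S := by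
  unfold topk
  rw [List.take_of_length_le (by simpa using h), Multiset.sort_eq]

theorem card_topk (k : ℕ) (S : Multiset ℝ) : (topk k S).card = min k S.card := by
  simp [topk]

theorem exists_eq_topk_add (k : ℕ) (S : Multiset ℝ) :
    ∃ D, S = topk k S + D ∧ ∀ x ∈ topk k S, ∀ y ∈ D, y ≤ x := by
  refine ⟨((S.sort (· ≥ ·)).drop k : List ℝ), ?_, ?_⟩
  · rw [topk, Multiset.coe_add, List.take_append_drop, Multiset.sort_eq]
  · have hp := Multiset.pairwise_sort S (· ≥ ·)
    rw [← List.take_append_drop k (S.sort (· ≥ ·)), List.pairwise_append] at hp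
    intro x hx y hy
    exact hp.2.2 x hx y hy

theorem topk_topk_add (k : ℕ) (S T : Multiset ℝ) : topk k (topk k S + T) = topk k (S + T) := by
  rcases le_total S.card k with hS | hS
  · rw [topk_eq_self_of_card_le k S hS]
  obtain ⟨D, hD, hDle⟩ := exists_eq_topk_add k S
  have hcard : (topk k S).card = k := by rw [card_topk, min_eq_left hS]
  generalize topk k S = Q at *
  subst hD
  obtain ⟨R, hR, hRle⟩ := exists_eq_topk_add k (Q + T)
  have hPcard : (topk k (Q + T)).card = k := by
    rw [card_topk, Multiset.card_add, hcard, min_eq_left (Nat.le_add_right k _)]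
  generalize topk k (Q + T) = P at *
  have hPD : ∀ x ∈ P, ∀ y ∈ R + D, y ≤ x := by
    intro p hp d hd
    rcases Multiset.mem_add.1 hd with hd | hd
    · exact hRle p hp d hd
    by_contra! hlt
    have hdisj : Disjoint Q R := Multiset.disjoint_left.2 fun {x} hx hxR =>
      absurd (hDle x hx d hd) (not_le.2 ((hRle p hp x hxR).trans_lt hlt))
    have hQP : Q ≤ P := by
      have hle : Q ≤ P + R := hR ▸ Multiset.le_add_right Q T
      rw [Multiset.le_iff_count] at hle ⊢
      intro a
      by_cases ha : a ∈ Q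
      · have := hle a
        rwa [Multiset.count_add,
          Multiset.count_eq_zero_of_notMem (Multiset.disjoint_left.1 hdisj ha), add_zero] at this
      · simp [Multiset.count_eq_zero_of_notMem ha]
    have hEq : Q = P := Multiset.eq_of_le_of_card_le hQP (by rw [hcard, hPcard])
    exact absurd (hDle p (hEq ▸ hp) d hd) (not_le.2 hlt)
  have hsum : Q + D + T = P + (R + D) := by rw [add_right_comm, hR, add_assoc]
  rw [hsum, topk_add_of_forall_le k P (R + D) hPcard.ge hPD, ← topk_eq_self_of_card_le k P hPcard.le]
  exact (topk_eq_self_of_card_le k _ (card_topk k P ▸ min_le_left _ _)).symm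

theorem topk_add_topk (k : ℕ) (S T : Multiset ℝ) : topk k (S + topk k T) = topk k (S + T) := by
  rw [add_comm, topk_topk_add, add_comm]

theorem subSums_append (A₁ A₂ : List ℝ) :
    subSums (A₁ ++ A₂) = subSums A₁ + subSums A₂ + crossingSums A₁ A₂ := by
  have hcross : crossingSums A₁ A₂ = (Multiset.range A₁.length).bind fun i =>
      (Multiset.range A₂.length).map fun t =>
        (((A₁ ++ A₂).drop i).take (A₁.length + t + 1 - i)).sum := by
    rw [crossingSums, Finset.product_val]
    simp only [Finset.range_val, SProd.sprod, Multiset.product, Multiset.map_bind,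
      Multiset.map_map, Function.comp_def]
  have hleft : ∀ i ∈ Multiset.range A₁.length,
      ((Multiset.range ((A₁ ++ A₂).length - i)).map fun l =>
        (((A₁ ++ A₂).drop i).take (l + 1)).sum) =
      ((Multiset.range (A₁.length - i)).map fun l => ((A₁.drop i).take (l + 1)).sum) +
      (Multiset.range A₂.length).map fun t =>
        (((A₁ ++ A₂).drop i).take (A₁.length + t + 1 - i)).sum := by
    intro i hi
    rw [Multiset.mem_range] at hi
    rw [List.length_append, Nat.sub_add_comm hi.le, Multiset.range_add, Multiset.map_add,
      Multiset.map_map]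
    congr 1
    · refine Multiset.map_congr rfl fun l hl => ?_
      rw [Multiset.mem_range] at hl
      rw [List.drop_append_of_le_length hi.le,
        List.take_append_of_le_length (by rw [List.length_drop]; omega)]
    · refine Multiset.map_congr rfl fun t _ => ?_
      have : A₁.length - i + t + 1 = A₁.length + t + 1 - i := by omega
      rw [Function.comp_apply, this]
  have hright : ∀ j, ((Multiset.range ((A₁ ++ A₂).length - (A₁.length + j))).map fun l =>
        (((A₁ ++ A₂).drop (A₁.length + j)).take (l + 1)).sum) =
      (Multiset.range (A₂.length - j)).map fun l => ((A₂.drop j).take (l + 1)).sum := by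
    intro j
    rw [List.length_append, Nat.add_sub_add_left, List.drop_length_add_append]
  rw [hcross]
  simp only [subSums, Finset.range_val]
  rw [List.length_append, Multiset.range_add, Multiset.add_bind, Multiset.bind_map,
    ← List.length_append, Multiset.bind_congr hleft, Multiset.bind_add]
  simp only [hright]
  exact add_right_comm _ _ _

/-- Correctness of the combine step of the divide-and-conquer `k`-maximum subarrays
algorithm: for nonempty lists `A₁`, `A₂` of reals and every `k`, the `k` largest subarray
sums of `A₁ ++ A₂` are the `k` largest among the `k` largest subarray sums of `A₁`, the
`k` largest subarray sums of `A₂`, and the `k` largest crossing sums. -/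
theorem topk_subSums_append (A₁ A₂ : List ℝ) (h₁ : A₁ ≠ []) (h₂ : A₂ ≠ []) (k : ℕ) :
    topk k (subSums (A₁ ++ A₂)) =
      topk k (topk k (subSums A₁) + topk k (subSums A₂) + topk k (crossingSums A₁ A₂)) := by
  rw [subSums_append, topk_add_topk, add_assoc (topk k _), topk_topk_add,
    add_left_comm (subSums A₁) (topk k _), topk_topk_add, add_left_comm (subSums A₂), ← add_assoc]
end

section
/- Let n ∈ ℕ and let A, B : Fin n → ℝ be nonincreasing. For every m with 0 ≤ m ≤ n², there exists a set D ⊆ Fin n × Fin n of cardinality m that is a lower set for the componentwise order and such that A(i) + B(j) ≥ A(i') + B(j') for every (i,j) ∈ D and every (i',j') ∉ D; i.e., the m largest pairwise sums can always be realized by a down-set of index pairs. (This is the invariant underlying the heap-based MAX_SUM_CROSS algorithm.) -/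
/-- In a finite partial order, the `m` largest values of an antitone function are attained on some
lower set of cardinality `m`. -/
theorem Antitone.exists_isLowerSet_card_eq {α β : Type*} [PartialOrder α] [Fintype α]
    [LinearOrder β] {f : α → β} (hf : Antitone f) {m : ℕ} (hm : m ≤ Fintype.card α) :
    ∃ D : Finset α, D.card = m ∧ IsLowerSet (↑D : Set α) ∧ ∀ p ∈ D, ∀ q ∉ D, f q ≤ f p := by
  classical
  induction m with
  | zero => exact ⟨∅, by simp [isLowerSet_empty]⟩
  | succ m ih =>
    obtain ⟨D, hcard, hlow, hD⟩ := ih (by lia)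
    have hne : Dᶜ.Nonempty := by
      rw [← Finset.card_pos, Finset.card_compl]
      lia
    obtain ⟨x, hx, hmax⟩ := Finset.exists_max_image Dᶜ f hne
    obtain ⟨y, hy⟩ := (Dᶜ.filter fun z => f x ≤ f z).exists_minimal ⟨x, by simp_all⟩
    obtain ⟨hyD, hxy⟩ : y ∉ D ∧ f x ≤ f y := by simpa using hy.prop
    refine ⟨insert y D, by rw [Finset.card_insert_of_notMem hyD, hcard], ?_, ?_⟩
    · intro a b hba ha
      rw [Finset.mem_coe, Finset.mem_insert] at ha ⊢
      rcases ha with rfl | ha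
      · by_cases hb : b ∈ D
        · exact Or.inr hb
        · have hmem : b ∈ Dᶜ.filter fun z => f x ≤ f z := by
            simpa [hb] using hxy.trans (hf hba)
          exact Or.inl (hba.antisymm (hy.le_of_le hmem hba))
      · exact Or.inr (hlow hba ha)
    · intro p hp q hq
      have hqD : q ∉ D := fun h => hq (Finset.mem_insert_of_mem h)
      rcases Finset.mem_insert.mp hp with rfl | hp
      · exact (hmax q (Finset.mem_compl.mpr hqD)).trans hxy
      · exact hD p hp q hqD

/-- Invariant of the heap-based MAX_SUM_CROSS algorithm: if `A, B : Fin n → ℝ` are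
nonincreasing, then for every `m ≤ n²` there is a set `D` of `m` index pairs that is a
lower set for the componentwise order on `Fin n × Fin n` and satisfies
`A i + B j ≥ A i' + B j'` for every `(i,j) ∈ D` and `(i',j') ∉ D`: the `m` largest
pairwise sums can always be realized by a down-set of index pairs. -/
theorem exists_lowerSet_of_largest_sums (n : ℕ) (A B : Fin n → ℝ)
    (hA : Antitone A) (hB : Antitone B) (m : ℕ) (hm : m ≤ n ^ 2) :
    ∃ D : Finset (Fin n × Fin n), D.card = m ∧ IsLowerSet (↑D : Set (Fin n × Fin n)) ∧
      ∀ p ∈ D, ∀ q : Fin n × Fin n, q ∉ D → A q.1 + B q.2 ≤ A p.1 + B p.2 := by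
  have hf : Antitone fun p : Fin n × Fin n => A p.1 + B p.2 :=
    fun _ _ h => add_le_add (hA h.1) (hB h.2)
  exact hf.exists_isLowerSet_card_eq (by simpa [sq] using hm)
end
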